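/- Let g ≥ 2, τ ∈ ℍ_{g−1}, z ∈ ℂ^{g−1}, ε, δ ∈ {0,1}^{g−1} and δ₁ ∈ {0,1}. If δ₁ + ε·δ is even (where ε·δ = Σ_j ε_j δ_j), then lim_{t→+∞} q_t^{−1}·θ_{[(1,ε),(δ₁,δ)]}(T_t) = 2·e^{πiδ₁/2}·θ_{[ε,δ]}(τ, z/2). If δ₁ + ε·δ is odd, then θ_{[(1,ε),(δ₁,δ)]}(T_t) = 0 for all sufficiently large t (the genus-g characteristic [(1,ε),(δ₁,δ)] is odd, so its theta constant vanishes identically). -/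

import Mathlib

open scoped BigOperators

noncomputable section

/-- The Siegel upper half-space: symmetric complex matrices with positive
definite imaginary part (indexed by a finite type `ι`). -/
def Siegel (ι : Type) [Fintype ι] : Set (Matrix ι ι ℂ) :=
  {τ | τ.IsSymm ∧ ∀ v : ι → ℝ, v ≠ 0 → 0 < ∑ i, ∑ j, v i * (τ i j).im * v j}

/-- The theta function with characteristic `[ε, δ]`. -/
def theta {ι : Type} [Fintype ι] (ε δ : ι → ZMod 2) (τ : Matrix ι ι ℂ) (z : ι → ℂ) : ℂ :=
  ∑' n : ι → ℤ, Complex.exp ((Real.pi : ℂ) * Complex.I *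
    ((∑ i, ∑ j, ((n i : ℂ) + ((ε i).val : ℂ) / 2) * τ i j * ((n j : ℂ) + ((ε j).val : ℂ) / 2)) +
     2 * ∑ i, ((n i : ℂ) + ((ε i).val : ℂ) / 2) * (z i + ((δ i).val : ℂ) / 2)))

/-- A theta characteristic, an element of `𝔽₂^{2g}`. -/
abbrev Char2 (ι : Type) := (ι → ZMod 2) × (ι → ZMod 2)

/-- Theta function, with the characteristic as a pair. -/
def thetaChar {ι : Type} [Fintype ι] (m : Char2 ι) (τ : Matrix ι ι ℂ) (z : ι → ℂ) : ℂ :=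
  theta m.1 m.2 τ z

/-- Theta constant. -/
def thetaConst {ι : Type} [Fintype ι] (m : Char2 ι) (τ : Matrix ι ι ℂ) : ℂ :=
  thetaChar m τ 0

/-- The degenerating period matrix `T_t = [[it, zᵀ],[z, τ]]`. -/
noncomputable def Tmat {n : ℕ} (t : ℝ) (z : Fin n → ℂ) (τ : Matrix (Fin n) (Fin n) ℂ) :
    Matrix (Fin 1 ⊕ Fin n) (Fin 1 ⊕ Fin n) ℂ :=
  Matrix.fromBlocks (Matrix.of fun _ _ => (t : ℂ) * Complex.I)
    (Matrix.of fun _ j => z j) (Matrix.of fun i _ => z i) τ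

/-- The boundary parameter `q_t = e^{−πt/4}`. -/
noncomputable def qdeg (t : ℝ) : ℝ := Real.exp (-Real.pi * t / 4)

/-- The genus-`g` characteristic `[(ε₁,ε),(δ₁,δ)]`. -/
def extChar {n : ℕ} (ε₁ δ₁ : ZMod 2) (ε δ : Fin n → ZMod 2) : Char2 (Fin 1 ⊕ Fin n) :=
  (Sum.elim (fun _ => ε₁) ε, Sum.elim (fun _ => δ₁) δ)

/-- The summand of the theta series. -/
def thetaTerm {ι : Type} [Fintype ι] (ε δ : ι → ZMod 2) (τ : Matrix ι ι ℂ) (z : ι → ℂ)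
    (n : ι → ℤ) : ℂ :=
  Complex.exp ((Real.pi : ℂ) * Complex.I *
    ((∑ i, ∑ j, ((n i : ℂ) + ((ε i).val : ℂ) / 2) * τ i j * ((n j : ℂ) + ((ε j).val : ℂ) / 2)) +
     2 * ∑ i, ((n i : ℂ) + ((ε i).val : ℂ) / 2) * (z i + ((δ i).val : ℂ) / 2)))

lemma theta_eq_tsum_thetaTerm {ι : Type} [Fintype ι] (ε δ : ι → ZMod 2) (τ : Matrix ι ι ℂ)
    (z : ι → ℂ) : theta ε δ τ z = ∑' n, thetaTerm ε δ τ z n := rfl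

lemma thetaTerm_reflect {ι : Type} [Fintype ι] (ε δ : ι → ZMod 2) (τ : Matrix ι ι ℂ)
    (z : ι → ℂ) (n : ι → ℤ) :
    thetaTerm ε δ τ (-z) (fun i => -((ε i).val : ℤ) - n i) =
      (-1) ^ (∑ i, (ε i).val * (δ i).val) * thetaTerm ε δ τ z n := by
  have hsign : ((-1 : ℂ)) ^ (∑ i, (ε i).val * (δ i).val) =
      Complex.exp ((Real.pi : ℂ) * Complex.I *
        -(2 * ∑ i, ((n i : ℂ) + ((ε i).val : ℂ) / 2) * ((δ i).val : ℂ))) := by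
    have hsplit : (Real.pi : ℂ) * Complex.I *
        -(2 * ∑ i, ((n i : ℂ) + ((ε i).val : ℂ) / 2) * ((δ i).val : ℂ)) =
        ((∑ i, (ε i).val * (δ i).val : ℕ) : ℂ) * (Real.pi * Complex.I) +
        ((-(∑ i, (n i * ((δ i).val : ℤ) + (ε i).val * (δ i).val)) : ℤ) : ℂ) *
          (2 * Real.pi * Complex.I) := by
      push_cast
      simp only [Finset.sum_add_distrib, add_mul, div_mul_eq_mul_div, ← Finset.sum_div]
      ring
    rw [hsplit, Complex.exp_add, Complex.exp_int_mul_two_pi_mul_I, mul_one, Complex.exp_nat_mul,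
      Complex.exp_pi_mul_I]
  rw [hsign, thetaTerm, thetaTerm, ← Complex.exp_add, ← mul_add]
  congr 2
  have hw (i : ι) : ((-((ε i).val : ℤ) - n i : ℤ) : ℂ) + ((ε i).val : ℂ) / 2 =
      -((n i : ℂ) + ((ε i).val : ℂ) / 2) := by
    push_cast
    ring
  simp only [hw, neg_mul, mul_neg, neg_neg]
  have hlin : ∑ i, -(((n i : ℂ) + ((ε i).val : ℂ) / 2) * ((-z) i + ((δ i).val : ℂ) / 2)) =
      -∑ i, ((n i : ℂ) + ((ε i).val : ℂ) / 2) * ((δ i).val : ℂ) +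
        ∑ i, ((n i : ℂ) + ((ε i).val : ℂ) / 2) * (z i + ((δ i).val : ℂ) / 2) := by
    rw [← Finset.sum_neg_distrib, ← Finset.sum_add_distrib]
    refine Finset.sum_congr rfl fun i _ => ?_
    rw [Pi.neg_apply]
    ring
  rw [hlin]
  ring

/-- Parity of the theta function. -/
lemma theta_neg {ι : Type} [Fintype ι] (ε δ : ι → ZMod 2) (τ : Matrix ι ι ℂ) (z : ι → ℂ) :
    theta ε δ τ (-z) = (-1) ^ (∑ i, (ε i).val * (δ i).val) * theta ε δ τ z := by
  rw [theta_eq_tsum_thetaTerm, theta_eq_tsum_thetaTerm, ← tsum_mul_left,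
    ← (Equiv.subLeft fun i => -((ε i).val : ℤ)).tsum_eq]
  exact tsum_congr fun n => thetaTerm_reflect ε δ τ z n

lemma norm_thetaTerm {ι : Type} [Fintype ι] (ε δ : ι → ZMod 2) (τ : Matrix ι ι ℂ)
    (z : ι → ℂ) (n : ι → ℤ) :
    ‖thetaTerm ε δ τ z n‖ = Real.exp (-Real.pi *
      ((∑ i, ∑ j, ((n i : ℝ) + ((ε i).val : ℝ) / 2) * (τ i j).im *
        ((n j : ℝ) + ((ε j).val : ℝ) / 2)) +
      2 * ∑ i, ((n i : ℝ) + ((ε i).val : ℝ) / 2) * (z i).im)) := by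
  have hcast (i : ι) : (n i : ℂ) + ((ε i).val : ℂ) / 2 =
      (((n i : ℝ) + ((ε i).val : ℝ) / 2 : ℝ) : ℂ) := by push_cast; rfl
  have hδ (i : ι) : ((δ i).val : ℂ) / 2 = (((δ i).val / 2 : ℝ) : ℂ) := by push_cast; rfl
  rw [thetaTerm, Complex.norm_exp]
  simp only [hcast, hδ]
  congr 1
  rw [mul_assoc, Complex.re_ofReal_mul, Complex.I_mul_re, Complex.add_im,
    show (2 : ℂ) = ((2 : ℝ) : ℂ) by norm_num, Complex.im_ofReal_mul, Complex.im_sum,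
    Complex.im_sum]
  simp only [Complex.im_sum, Complex.im_mul_ofReal, Complex.im_ofReal_mul, Complex.add_im,
    Complex.ofReal_im, add_zero]
  ring

/-- The summand for the degenerating matrix, split along its first coordinate. -/
lemma thetaTerm_extChar_Tmat {n : ℕ} (δ₁ : ZMod 2) (ε δ : Fin n → ZMod 2) (t : ℝ)
    (z : Fin n → ℂ) (τ : Matrix (Fin n) (Fin n) ℂ) (m : ℤ) (k : Fin n → ℤ) :
    thetaTerm (extChar 1 δ₁ ε δ).1 (extChar 1 δ₁ ε δ).2 (Tmat t z τ) 0
        (Sum.elim (fun _ => m) k) =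
      Complex.exp (-(Real.pi * t * ((m : ℂ) + 1 / 2) ^ 2)) *
        (Complex.exp (Real.pi * Complex.I * (((m : ℂ) + 1 / 2) * δ₁.val)) *
          thetaTerm ε δ τ (fun i => ((m : ℂ) + 1 / 2) * z i) k) := by
  have h1 : ((1 : ZMod 2).val : ℂ) = 1 := by simp [ZMod.val_one]
  rw [thetaTerm, thetaTerm, ← Complex.exp_add, ← Complex.exp_add]
  congr 1
  simp only [extChar, Tmat, Fintype.sum_sum_type, Sum.elim_inl, Sum.elim_inr,
    Matrix.fromBlocks_apply₁₁, Matrix.fromBlocks_apply₁₂, Matrix.fromBlocks_apply₂₁,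
    Matrix.fromBlocks_apply₂₂, Matrix.of_apply, Finset.univ_unique, Finset.sum_singleton, h1,
    Pi.zero_apply, zero_add, Finset.sum_add_distrib]
  have hrow : ∑ j, ((m : ℂ) + 1 / 2) * z j * ((k j : ℂ) + ((ε j).val : ℂ) / 2) =
      ((m : ℂ) + 1 / 2) * ∑ j, ((k j : ℂ) + ((ε j).val : ℂ) / 2) * z j := by
    rw [Finset.mul_sum]
    exact Finset.sum_congr rfl fun j _ => by ring
  have hcol : ∑ j, ((k j : ℂ) + ((ε j).val : ℂ) / 2) * z j * ((m : ℂ) + 1 / 2) =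
      ((m : ℂ) + 1 / 2) * ∑ j, ((k j : ℂ) + ((ε j).val : ℂ) / 2) * z j := by
    rw [← Finset.sum_mul, mul_comm]
  have hlin : ∑ j, ((k j : ℂ) + ((ε j).val : ℂ) / 2) *
        (((m : ℂ) + 1 / 2) * z j + ((δ j).val : ℂ) / 2) =
      ((m : ℂ) + 1 / 2) * ∑ j, ((k j : ℂ) + ((ε j).val : ℂ) / 2) * z j +
        ∑ j, ((k j : ℂ) + ((ε j).val : ℂ) / 2) * (((δ j).val : ℂ) / 2) := by
    rw [Finset.mul_sum, ← Finset.sum_add_distrib]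
    exact Finset.sum_congr rfl fun j _ => by ring
  rw [hrow, hcol, hlin]
  linear_combination (Real.pi * t * ((m : ℂ) + 1 / 2) ^ 2) * Complex.I_sq

lemma summable_exp_neg_sq {c : ℝ} (hc : 0 < c) (a : ℝ) :
    Summable fun n : ℤ => Real.exp (-Real.pi * (c * ((n : ℝ) + a) ^ 2)) := by
  have h := ((summable_jacobiTheta₂_term_iff ((c * a : ℝ) * Complex.I)
    ((c : ℂ) * Complex.I)).2 (by simpa using hc)).norm.mul_left (Real.exp (-Real.pi * (c * a ^ 2)))
  refine h.congr fun n => ?_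
  rw [norm_jacobiTheta₂_term, ← Real.exp_add]
  congr 1
  simp only [Complex.mul_I_im, Complex.ofReal_re]
  ring

lemma summable_fin_prod_of_nonneg {n : ℕ} {β : Type} (f : Fin n → β → ℝ)
    (hf : ∀ i, Summable (f i)) (h0 : ∀ i b, 0 ≤ f i b) :
    Summable fun x : Fin n → β => ∏ i, f i (x i) := by
  induction n with
  | zero => exact Summable.of_finite
  | succ n ih =>
    rw [← (Fin.consEquiv fun _ => β).summable_iff]
    refine ((hf 0).mul_of_nonneg (ih (fun i => f i.succ) (fun i => hf _) fun i => h0 _)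
      (h0 0) fun x => Finset.prod_nonneg fun i _ => h0 _ _).congr fun x => ?_
    simp [Fin.prod_univ_succ, Fin.consEquiv]

/-- The imaginary part of a point of the Siegel upper half-space is coercive. -/
lemma Siegel.exists_coercive {ι : Type} [Fintype ι] {τ : Matrix ι ι ℂ} (hτ : τ ∈ Siegel ι) :
    ∃ c : ℝ, 0 < c ∧ ∀ v : ι → ℝ, c * ∑ i, v i ^ 2 ≤ ∑ i, ∑ j, v i * (τ i j).im * v j := by
  rcases isEmpty_or_nonempty ι with hι | hι
  · exact ⟨1, one_pos, fun v => by simp⟩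
  obtain ⟨u, hu, hmin⟩ := (isCompact_sphere (0 : ι → ℝ) 1).exists_isMinOn
    (NormedSpace.sphere_nonempty.2 zero_le_one)
    (f := fun v : ι → ℝ => ∑ i, ∑ j, v i * (τ i j).im * v j) (by fun_prop)
  have hu0 : u ≠ 0 := by
    rintro rfl
    simp at hu
  have hpos := hτ.2 u hu0
  set μ := ∑ i, ∑ j, u i * (τ i j).im * u j
  have hcard : 0 < (Fintype.card ι : ℝ) := by exact_mod_cast Fintype.card_pos
  refine ⟨μ / Fintype.card ι, by positivity, fun v => ?_⟩
  rcases eq_or_ne v 0 with rfl | hv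
  · simp
  have hv' : 0 < ‖v‖ := norm_pos_iff.2 hv
  have hscaled : μ ≤ ∑ i, ∑ j, (‖v‖⁻¹ • v) i * (τ i j).im * (‖v‖⁻¹ • v) j :=
    hmin (by simp [norm_smul, hv'.ne'])
  have hhom : ∑ i, ∑ j, (‖v‖⁻¹ • v) i * (τ i j).im * (‖v‖⁻¹ • v) j =
      (‖v‖ ^ 2)⁻¹ * ∑ i, ∑ j, v i * (τ i j).im * v j := by
    simp only [Finset.mul_sum, Pi.smul_apply, smul_eq_mul]
    refine Finset.sum_congr rfl fun i _ => Finset.sum_congr rfl fun j _ => by ring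
  rw [hhom, le_inv_mul_iff₀ (by positivity)] at hscaled
  have hsq : ∑ i, v i ^ 2 ≤ Fintype.card ι * ‖v‖ ^ 2 := by
    calc ∑ i, v i ^ 2 ≤ ∑ _i : ι, ‖v‖ ^ 2 := Finset.sum_le_sum fun i _ => by
          rw [← sq_abs]
          exact pow_le_pow_left₀ (abs_nonneg _) (norm_le_pi_norm v i) 2
      _ = _ := by simp
  calc μ / Fintype.card ι * ∑ i, v i ^ 2
      ≤ μ / Fintype.card ι * (Fintype.card ι * ‖v‖ ^ 2) := by gcongr
    _ = ‖v‖ ^ 2 * μ := by field_simp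
    _ ≤ _ := hscaled

/-- For large `t` the theta series of the degenerating matrix converges absolutely. -/
lemma exists_summable_norm_thetaTerm {n : ℕ} (ε δ : Fin n → ZMod 2)
    {τ : Matrix (Fin n) (Fin n) ℂ} (hτ : τ ∈ Siegel (Fin n)) (z : Fin n → ℂ) :
    ∃ t : ℝ, Summable fun p : ℤ × (Fin n → ℤ) =>
      Real.exp (-(Real.pi * t * ((p.1 : ℝ) + 1 / 2) ^ 2)) *
        ‖thetaTerm ε δ τ (fun i => ((p.1 : ℂ) + 1 / 2) * z i) p.2‖ := by
  obtain ⟨c, hc, hcoer⟩ := Siegel.exists_coercive hτ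
  refine ⟨1 + 2 / c * ∑ i, (z i).im ^ 2, ?_⟩
  have hsum := (summable_exp_neg_sq one_pos (1 / 2)).mul_of_nonneg
    (summable_fin_prod_of_nonneg
      (fun i (k : ℤ) => Real.exp (-Real.pi * (c / 2 * ((k : ℝ) + ((ε i).val : ℝ) / 2) ^ 2)))
      (fun i => summable_exp_neg_sq (by positivity) _) fun i k => (Real.exp_pos _).le)
    (fun _ => (Real.exp_pos _).le) fun _ => Finset.prod_nonneg fun _ _ => (Real.exp_pos _).le
  refine Summable.of_nonneg_of_le (fun p => by positivity) (fun p => ?_) hsum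
  rw [norm_thetaTerm, ← Real.exp_sum, ← Real.exp_add, ← Real.exp_add, Real.exp_le_exp]
  set a : ℝ := (p.1 : ℝ) + 1 / 2 with ha
  have hQ := hcoer fun i => (p.2 i : ℝ) + ((ε i).val : ℝ) / 2
  set Q := ∑ i, ∑ j, ((p.2 i : ℝ) + ((ε i).val : ℝ) / 2) * (τ i j).im *
        ((p.2 j : ℝ) + ((ε j).val : ℝ) / 2)
  have him (i : Fin n) : (((p.1 : ℂ) + 1 / 2) * z i).im = a * (z i).im := by
    rw [show (p.1 : ℂ) + 1 / 2 = ((a : ℝ) : ℂ) by rw [ha]; push_cast; rfl, Complex.im_ofReal_mul]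
  simp only [him]
  have hcross : 0 ≤ ∑ i, (2 / c * (z i).im ^ 2 * a ^ 2 +
      2 * (((p.2 i : ℝ) + ((ε i).val : ℝ) / 2) * (a * (z i).im)) +
      c / 2 * ((p.2 i : ℝ) + ((ε i).val : ℝ) / 2) ^ 2) := by
    refine Finset.sum_nonneg fun i _ => ?_
    have hsq : 2 / c * (z i).im ^ 2 * a ^ 2 +
      2 * (((p.2 i : ℝ) + ((ε i).val : ℝ) / 2) * (a * (z i).im)) +
      c / 2 * ((p.2 i : ℝ) + ((ε i).val : ℝ) / 2) ^ 2 = 2 / c * (a * (z i).im +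
        c / 2 * ((p.2 i : ℝ) + ((ε i).val : ℝ) / 2)) ^ 2 := by
      field_simp
      ring
    rw [hsq]
    positivity
  simp only [Finset.sum_add_distrib, ← Finset.mul_sum, ← Finset.sum_mul] at hcross ⊢
  nlinarith [Real.pi_pos, mul_nonneg Real.pi_pos.le hcross,
    mul_nonneg Real.pi_pos.le (sub_nonneg.2 hQ)]

/-- Splitting off the coordinate in `Fin 1`. -/
def intTupleSumEquiv (n : ℕ) : ℤ × (Fin n → ℤ) ≃ (Fin 1 ⊕ Fin n → ℤ) :=
  ((Equiv.funUnique (Fin 1) ℤ).symm.prodCongr (Equiv.refl _)).trans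
    (Equiv.sumArrowEquivProdArrow (Fin 1) (Fin n) ℤ).symm

lemma intTupleSumEquiv_apply {n : ℕ} (p : ℤ × (Fin n → ℤ)) :
    intTupleSumEquiv n p = Sum.elim (fun _ => p.1) p.2 := rfl

lemma inv_qdeg_mul_thetaConst {n : ℕ} (δ₁ : ZMod 2) (ε δ : Fin n → ZMod 2) (t : ℝ)
    (z : Fin n → ℂ) (τ : Matrix (Fin n) (Fin n) ℂ) :
    ((qdeg t : ℂ))⁻¹ * thetaConst (extChar 1 δ₁ ε δ) (Tmat t z τ) =
      ∑' p : ℤ × (Fin n → ℤ), (Real.exp (-(Real.pi * t * ((p.1 : ℝ) * (p.1 + 1)))) : ℂ) *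
        (Complex.exp (Real.pi * Complex.I * (((p.1 : ℂ) + 1 / 2) * δ₁.val)) *
          thetaTerm ε δ τ (fun i => ((p.1 : ℂ) + 1 / 2) * z i) p.2) := by
  rw [thetaConst, thetaChar, theta_eq_tsum_thetaTerm, ← (intTupleSumEquiv n).tsum_eq,
    ← tsum_mul_left]
  refine tsum_congr fun p => ?_
  rw [intTupleSumEquiv_apply, thetaTerm_extChar_Tmat, ← mul_assoc]
  congr 1
  rw [qdeg, Complex.ofReal_exp, Complex.ofReal_exp, ← Complex.exp_neg, ← Complex.exp_add]
  congr 1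
  push_cast
  ring

lemma Int.mul_add_one_nonneg (m : ℤ) : (0 : ℝ) ≤ (m : ℝ) * (m + 1) := by
  have h : 0 ≤ m * (m + 1) := by
    rcases le_or_gt 0 m with h | h
    · positivity
    · nlinarith
  exact_mod_cast h

lemma norm_exp_pi_mul_I_mul_half_int (m : ℤ) (d : ℕ) :
    ‖Complex.exp (Real.pi * Complex.I * (((m : ℂ) + 1 / 2) * d))‖ = 1 := by
  rw [show (Real.pi : ℂ) * Complex.I * (((m : ℂ) + 1 / 2) * d) =
    ((Real.pi * ((m + 1 / 2) * d) : ℝ) : ℂ) * Complex.I by push_cast; ring,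
    Complex.norm_exp_ofReal_mul_I]

open Filter in
/-- Only the summands with first coordinate `0` or `-1` survive in the limit. -/
lemma tendsto_inv_qdeg_mul_thetaConst {n : ℕ} {τ : Matrix (Fin n) (Fin n) ℂ}
    (hτ : τ ∈ Siegel (Fin n)) (z : Fin n → ℂ) (ε δ : Fin n → ZMod 2) (δ₁ : ZMod 2) :
    Tendsto (fun t : ℝ => ((qdeg t : ℂ))⁻¹ * thetaConst (extChar 1 δ₁ ε δ) (Tmat t z τ)) atTop
      (nhds (Complex.exp (Real.pi * Complex.I * δ₁.val / 2) * theta ε δ τ (fun i => z i / 2) +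
        Complex.exp (-(Real.pi * Complex.I * δ₁.val / 2)) *
          theta ε δ τ (-fun i => z i / 2))) := by
  obtain ⟨t₀, hsum⟩ := exists_summable_norm_thetaTerm ε δ hτ z
  set A : ℤ × (Fin n → ℤ) → ℂ := fun p =>
    Complex.exp (Real.pi * Complex.I * (((p.1 : ℂ) + 1 / 2) * δ₁.val)) *
      thetaTerm ε δ τ (fun i => ((p.1 : ℂ) + 1 / 2) * z i) p.2 with hA
  have hnormA (p) : ‖A p‖ = ‖thetaTerm ε δ τ (fun i => ((p.1 : ℂ) + 1 / 2) * z i) p.2‖ := by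
    rw [hA, norm_mul, norm_exp_pi_mul_I_mul_half_int, one_mul]
  have hbound : Summable fun p : ℤ × (Fin n → ℤ) =>
      Real.exp (-(Real.pi * t₀ * ((p.1 : ℝ) * (p.1 + 1)))) * ‖A p‖ := by
    refine (hsum.mul_left (Real.exp (Real.pi * t₀ / 4))).congr fun p => ?_
    rw [hnormA, ← mul_assoc, ← Real.exp_add]
    congr 2
    ring
  have hsupp {m : ℤ} (h0 : m ≠ 0) (h1 : m ≠ -1) : (1 : ℝ) ≤ (m : ℝ) * (m + 1) := by
    have : 0 < m * (m + 1) := by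
      rcases lt_or_gt_of_ne h0 with h | h
      · have : m + 1 < 0 := by omega
        exact mul_pos_of_neg_of_neg h this
      · positivity
    exact_mod_cast this
  set G : ℤ × (Fin n → ℤ) → ℂ := fun p => if p.1 = 0 ∨ p.1 = -1 then A p else 0 with hG
  have hlim : Tendsto (fun t : ℝ => ((qdeg t : ℂ))⁻¹ *
      thetaConst (extChar 1 δ₁ ε δ) (Tmat t z τ)) atTop (nhds (∑' p, G p)) := by
    simp only [inv_qdeg_mul_thetaConst]
    refine tendsto_tsum_of_dominated_convergence hbound (fun p => ?_) ?_
    · by_cases hp : p.1 = 0 ∨ p.1 = -1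
      · have hz : (p.1 : ℝ) * (p.1 + 1) = 0 := by rcases hp with h | h <;> simp [h]
        simp only [hG, if_pos hp, hz]
        simp [hA]
      · simp only [hG, if_neg hp]
        rw [not_or] at hp
        have hpos := hsupp hp.1 hp.2
        have hexp : Tendsto (fun t : ℝ => Real.exp (-(Real.pi * t * ((p.1 : ℝ) * (p.1 + 1)))))
            atTop (nhds 0) := by
          refine Real.tendsto_exp_neg_atTop_nhds_zero.comp ?_
          exact (tendsto_id.const_mul_atTop Real.pi_pos).atTop_mul_const (by linarith)
        have hA0 := ((Complex.continuous_ofReal.tendsto 0).comp hexp).mul_const (A p)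
        rw [Complex.ofReal_zero, zero_mul] at hA0
        exact hA0
    · filter_upwards [eventually_ge_atTop t₀] with t ht p
      rw [norm_mul, Complex.norm_real, Real.norm_of_nonneg (Real.exp_pos _).le]
      refine mul_le_mul_of_nonneg_right (Real.exp_le_exp.2 (neg_le_neg ?_)) (norm_nonneg _)
      exact mul_le_mul_of_nonneg_right (mul_le_mul_of_nonneg_left ht Real.pi_pos.le)
        (Int.mul_add_one_nonneg _)
  convert hlim using 2
  have hGsum : Summable G := by
    refine hbound.of_norm_bounded fun p => ?_
    by_cases hp : p.1 = 0 ∨ p.1 = -1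
    · have hz : (p.1 : ℝ) * (p.1 + 1) = 0 := by rcases hp with h | h <;> simp [h]
      simp [hG, if_pos hp, hz]
    · simp only [hG, if_neg hp, norm_zero]
      positivity
  rw [hGsum.tsum_prod, tsum_eq_sum (s := {0, -1}) fun m hm => by
    have hm' : ¬ (m = 0 ∨ m = -1) := by simpa using hm
    simp [hG, hm']]
  rw [Finset.sum_pair (by norm_num)]
  simp only [hG, hA, true_or, or_true, if_true, tsum_mul_left, ← theta_eq_tsum_thetaTerm]
  congr 3
  · push_cast; ring
  · ext i
    push_cast
    ring
  · push_cast; ring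
  · ext i
    simp only [Pi.neg_apply]
    push_cast
    ring

open Filter in
/-- Fourier–Jacobi expansion of theta constants with characteristic `[(1,ε),(δ₁,δ)]`
near the boundary: if the genus-`g` characteristic is even then the leading term is
`2·e^{πiδ₁/2}·θ_{[ε,δ]}(τ,z/2)·q_t`, and if it is odd then the theta constant
vanishes identically. -/
theorem theta_const_boundary_expansion_odd_top (g : ℕ) (hg : 2 ≤ g)
    (τ : Matrix (Fin (g - 1)) (Fin (g - 1)) ℂ) (hτ : τ ∈ Siegel (Fin (g - 1)))
    (z : Fin (g - 1) → ℂ) (ε δ : Fin (g - 1) → ZMod 2) (δ₁ : ZMod 2) :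
    (Even (δ₁.val + ∑ j, (ε j).val * (δ j).val) →
      Tendsto (fun t : ℝ =>
          ((qdeg t : ℂ))⁻¹ * thetaConst (extChar 1 δ₁ ε δ) (Tmat t z τ)) atTop
        (nhds (2 * Complex.exp ((Real.pi : ℂ) * Complex.I * (δ₁.val : ℂ) / 2) *
          thetaChar (ε, δ) τ (fun i => z i / 2)))) ∧
    (Odd (δ₁.val + ∑ j, (ε j).val * (δ j).val) →
      ∃ t₀ : ℝ, ∀ t ≥ t₀, thetaConst (extChar 1 δ₁ ε δ) (Tmat t z τ) = 0) := by
  refine ⟨fun heven => ?_, fun hodd => ⟨0, fun t _ => ?_⟩⟩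
  · convert tendsto_inv_qdeg_mul_thetaConst hτ z ε δ δ₁ using 2
    have hexp : Complex.exp (-(Real.pi * Complex.I * δ₁.val / 2)) =
        (-1) ^ δ₁.val * Complex.exp (Real.pi * Complex.I * δ₁.val / 2) := by
      have hsplit : -((Real.pi : ℂ) * Complex.I * δ₁.val / 2) =
          -((δ₁.val : ℂ) * (Real.pi * Complex.I)) + Real.pi * Complex.I * δ₁.val / 2 := by ring
      rw [hsplit, Complex.exp_add, Complex.exp_neg, Complex.exp_nat_mul, Complex.exp_pi_mul_I,
        ← inv_pow, inv_neg_one]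
    have hsign : (-1 : ℂ) ^ δ₁.val * (-1) ^ (∑ j, (ε j).val * (δ j).val) = 1 := by
      rw [← pow_add, heven.neg_one_pow]
    rw [theta_neg, hexp, thetaChar]
    linear_combination -(Complex.exp (Real.pi * Complex.I * δ₁.val / 2) *
      theta ε δ τ fun i => z i / 2) * hsign
  · have h := theta_neg (extChar 1 δ₁ ε δ).1 (extChar 1 δ₁ ε δ).2 (Tmat t z τ) 0
    have hchar : Odd (∑ i, ((extChar 1 δ₁ ε δ).1 i).val * ((extChar 1 δ₁ ε δ).2 i).val) := by
      simpa [extChar, ZMod.val_one] using hodd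
    rw [hchar.neg_one_pow, neg_zero, neg_one_mul] at h
    exact self_eq_neg.1 h
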